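/- arXiv:1906.03736 — 2 statements merged into one kernel-verified Lean document; each statement's English description precedes it below -/
import Mathlib

section
/- Let m, n ≥ 0 and let f : (Fin m → Bool) → (Fin n → Bool) be an injective map such that whenever u and v differ in exactly one coordinate, f u and f v differ in exactly one coordinate (i.e. f is an embedding of the hypercube graph Q_m into the hypercube graph Q_n). Then the image of f is the vertex set of a face of I^n; that is, there exists a face F : Fin n → Option Bool with exactly m free coordinates whose vertex set equals the range of f. -/
/-- A face of the cube `I^n`: `none` marks a free coordinate. -/
def CubeFace (n : ℕ) : Type := Fin n → Option Bool

namespace CubeFace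

/-- The order on faces of the cube: `F ≤ G` iff every coordinate of `G` is free
or agrees with the corresponding coordinate of `F`. -/
instance (n : ℕ) : PartialOrder (CubeFace n) where
  le F G := ∀ i, G i = none ∨ F i = G i
  le_refl F i := Or.inr rfl
  le_trans F G H h1 h2 i := by
    rcases h2 i with h | h
    · exact Or.inl h
    · rcases h1 i with h' | h'
      · exact Or.inl (h ▸ h')
      · exact Or.inr (h' ▸ h)
  le_antisymm F G h1 h2 := by
    funext i
    rcases h1 i with h | h
    · rcases h2 i with h' | h'
      · rw [h, h']
      · rw [← h', h]
    · exact h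

/-- The face of `I^n` corresponding to a vertex. -/
def toFace {n : ℕ} (v : Fin n → Bool) : CubeFace n := fun i => some (v i)

/-- The vertex set of a face. -/
def verts {n : ℕ} (F : CubeFace n) : Set (Fin n → Bool) := {v | toFace v ≤ F}

/-- The dimension of a face: its number of free coordinates. -/
def dim {n : ℕ} (F : CubeFace n) : ℕ :=
  (@Finset.filter _ (fun i => F i = none) (fun i => Option.instDecidableEq (F i) none) Finset.univ).card

/-- A subcomplex of `I^n`: a nonempty, downward closed set of faces. -/
def IsSubcomplex {n : ℕ} (K : Set (CubeFace n)) : Prop :=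
  K.Nonempty ∧ ∀ F ∈ K, ∀ G : CubeFace n, G ≤ F → G ∈ K

/-- The vertex set of a subcomplex. -/
def cvert {n : ℕ} (K : Set (CubeFace n)) : Set (Fin n → Bool) := {v | toFace v ∈ K}

/-- A subcomplex `Γ ⊆ K` is face-like if, for every face `F` of `K`, the set of vertices
of `F` belonging to `Γ` is empty or the vertex set of a face of `Γ`. -/
def FaceLike {n : ℕ} (K Γ : Set (CubeFace n)) : Prop :=
  ∀ F ∈ K, verts F ∩ cvert Γ = ∅ ∨ ∃ G ∈ Γ, verts F ∩ cvert Γ = verts G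

/-- The deletion `K ∖ Γ`: the faces of `K` with no vertex in `Γ`. -/
def delete {n : ℕ} (K Γ : Set (CubeFace n)) : Set (CubeFace n) :=
  {F | F ∈ K ∧ verts F ∩ cvert Γ = ∅}

/-- The geometric realization of a subcomplex of `I^n`, as a subset of `ℝ^n`. -/
def real {n : ℕ} (K : Set (CubeFace n)) : Set (Fin n → ℝ) :=
  ⋃ F ∈ K, {x | (∀ i, 0 ≤ x i ∧ x i ≤ 1) ∧
    ∀ i, (F i = some false → x i = 0) ∧ (F i = some true → x i = 1)}

/-- The boundary `∂F̂` of a face `F`: all faces strictly below `F`. -/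
def bdryHat {n : ℕ} (F : CubeFace n) : Set (CubeFace n) := {G | G ≤ F ∧ G ≠ F}

/-- The boundary of the cube `I^k`: all faces except the top one. -/
def boundaryCube (k : ℕ) : Set (CubeFace k) := {F | F ≠ fun _ => none}

/-- The `k`-skeleton of a subcomplex. -/
def skel {n : ℕ} (k : ℕ) (K : Set (CubeFace n)) : Set (CubeFace n) :=
  {F | F ∈ K ∧ dim F ≤ k}

/-- Isomorphism of cubical subcomplexes: a bijection between the vertex sets under which
vertex sets of faces correspond to vertex sets of faces. -/
def Iso {m n : ℕ} (K : Set (CubeFace m)) (L : Set (CubeFace n)) : Prop :=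
  ∃ f : (Fin m → Bool) → (Fin n → Bool),
    Set.BijOn f (cvert K) (cvert L) ∧
    ∀ W : Set (Fin m → Bool), W ⊆ cvert K →
      ((∃ F ∈ K, verts F = W) ↔ (∃ G ∈ L, verts G = f '' W))

/-- `K` has dimension `d`. -/
def HasDim {n : ℕ} (K : Set (CubeFace n)) (d : ℕ) : Prop :=
  (∀ F ∈ K, dim F ≤ d) ∧ ∃ F ∈ K, dim F = d

end CubeFace


/-- Flip one coordinate. -/
def cubeFlip {m : ℕ} (u : Fin m → Bool) (i : Fin m) : Fin m → Bool :=
  Function.update u i (!u i)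

theorem cubeFlip_apply {m : ℕ} (u : Fin m → Bool) (i k : Fin m) :
    cubeFlip u i k = if k = i then !u k else u k := by
  unfold cubeFlip
  by_cases h : k = i
  · subst h; simp
  · simp [h]

theorem cube_const {m : ℕ} {α : Type*} (g : (Fin m → Bool) → α)
    (h : ∀ u j, g (cubeFlip u j) = g u) (u v : Fin m → Bool) : g u = g v := by
  have key : ∀ S : Finset (Fin m), g (fun i => if i ∈ S then u i else v i) = g v := by
    intro S
    induction S using Finset.induction_on with
    | empty => simp
    | insert a S ha ih =>
      by_cases huv : u a = v a
      · rw [← ih]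
        congr 1
        funext i
        by_cases hi : i = a
        · subst hi; simp [ha, huv]
        · simp [hi]
      · rw [← ih, ← h _ a]
        congr 1
        funext i
        rw [cubeFlip_apply]
        by_cases hi : i = a
        · subst hi
          revert huv
          cases u i <;> cases v i <;> simp [ha]
        · simp [hi]
  simpa using key Finset.univ

theorem cubeFlip_invol {m : ℕ} (u : Fin m → Bool) (i : Fin m) :
    cubeFlip (cubeFlip u i) i = u := by
  funext k
  simp only [cubeFlip_apply]
  split_ifs <;> simp

theorem cubeFlip_comm {m : ℕ} (u : Fin m → Bool) (i j : Fin m) :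
    cubeFlip (cubeFlip u i) j = cubeFlip (cubeFlip u j) i := by
  funext k
  simp only [cubeFlip_apply]
  split_ifs <;> simp

theorem cubeFlip_inj {m : ℕ} (u : Fin m → Bool) (i j : Fin m)
    (h : cubeFlip u i = cubeFlip u j) : i = j := by
  by_contra hij
  have := congrFun h i
  simp [cubeFlip_apply, hij] at this

theorem cubeFlip_square {n : ℕ} (x : Fin n → Bool) (a b c d : Fin n) (hab : a ≠ b)
    (hac : a ≠ c) (h : cubeFlip (cubeFlip x a) c = cubeFlip (cubeFlip x b) d) : d = a := by
  by_contra hd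
  have := congrFun h a
  simp [cubeFlip_apply, hab, hac, Ne.symm hd] at this

open CubeFace in
/-- An embedding of the hypercube graph `Q_m` into `Q_n` has as its image
the vertex set of an `m`-dimensional face of `I^n`. -/
theorem image_of_cube_graph_embedding_is_face (m n : ℕ)
    (f : (Fin m → Bool) → (Fin n → Bool)) (hinj : Function.Injective f)
    (hedge : ∀ u v : Fin m → Bool,
      (Finset.univ.filter (fun i => u i ≠ v i)).card = 1 →
      (Finset.univ.filter (fun i => f u i ≠ f v i)).card = 1) :
    ∃ F : CubeFace n, dim F = m ∧ verts F = Set.range f := by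
  classical
  have hex : ∀ u i, ∃ a, f (cubeFlip u i) = cubeFlip (f u) a := by
    intro u i
    have h1 : (Finset.univ.filter (fun k => u k ≠ cubeFlip u i k)).card = 1 := by
      rw [Finset.card_eq_one]
      refine ⟨i, ?_⟩
      ext k
      by_cases hk : k = i <;> simp [cubeFlip_apply, hk]
    obtain ⟨a, ha⟩ := Finset.card_eq_one.mp (hedge _ _ h1)
    refine ⟨a, ?_⟩
    funext k
    have hk := Finset.ext_iff.mp ha k
    simp only [Finset.mem_filter, Finset.mem_univ, true_and, Finset.mem_singleton] at hk
    rw [cubeFlip_apply]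
    by_cases hka : k = a
    · have := hk.mpr hka
      rw [if_pos hka]
      revert this
      cases f u k <;> cases f (cubeFlip u i) k <;> simp
    · rw [if_neg hka]
      by_contra hne
      exact hka (hk.mp (Ne.symm hne))
  choose c hc using hex
  have hcinj : ∀ u i j, c u i = c u j → i = j := by
    intro u i j h
    apply cubeFlip_inj u
    apply hinj
    rw [hc, hc, h]
  have hstep : ∀ u j, c (cubeFlip u j) = c u := by
    intro u j
    funext i
    by_cases hij : i = j
    · subst hij
      have h := hc (cubeFlip u i) i
      rw [cubeFlip_invol, hc] at h
      have h2 : cubeFlip (cubeFlip (f u) (c u i)) (c u i) = f u := cubeFlip_invol _ _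
      exact (cubeFlip_inj _ _ _ (h2.trans h)).symm
    · have hsq : cubeFlip (cubeFlip (f u) (c u i)) (c (cubeFlip u i) j)
          = cubeFlip (cubeFlip (f u) (c u j)) (c (cubeFlip u j) i) := by
        rw [← hc, ← hc, ← hc, ← hc, cubeFlip_comm]
      refine cubeFlip_square _ _ _ _ _ (fun h => hij (hcinj _ _ _ h)) ?_ hsq
      intro h
      have h3 : f (cubeFlip (cubeFlip u i) j) = f u := by
        rw [hc, hc, ← h, cubeFlip_invol]
      have h4 := hinj h3
      have h5 := congrFun h4 i
      simp [cubeFlip_apply, hij] at h5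
  set z : Fin m → Bool := fun _ => false with hz
  set s := c z with hs
  have hcs : ∀ u, c u = s := fun u => cube_const c hstep u z
  have hsinj : Function.Injective s := fun i j h => hcinj z i j h
  have hon : ∀ u i, f u (s i) = xor (f z (s i)) (u i) := by
    intro u i
    have := cube_const (fun u => xor (f u (s i)) (u i)) (by
      intro u j
      simp only [hc, hcs, cubeFlip_apply, hsinj.eq_iff]
      split_ifs <;> simp) u z
    simp only [hz] at this ⊢
    rw [Bool.xor_false] at this
    rw [← this]
    simp
  have hoff : ∀ u k, k ∉ Set.range s → f u k = f z k := by
    intro u k hk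
    refine cube_const (fun u => f u k) ?_ u z
    intro u j
    simp only [hc, hcs, cubeFlip_apply]
    rw [if_neg]
    rintro rfl
    exact hk ⟨j, rfl⟩
  refine ⟨fun k => if k ∈ Set.range s then none else some (f z k), ?_, ?_⟩
  · unfold dim
    have : (Finset.univ.image s).card = m := by
      rw [Finset.card_image_of_injective _ hsinj]; simp
    refine Eq.trans ?_ this
    congr 1
    ext k
    simp
  · ext v
    constructor
    · intro hv
      refine ⟨fun i => xor (f z (s i)) (v (s i)), ?_⟩
      funext k
      by_cases hk : k ∈ Set.range s
      · obtain ⟨i, rfl⟩ := hk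
        rw [hon]; simp
      · rw [hoff _ _ hk]
        have h := hv k
        simp only [if_neg hk, toFace] at h
        have h2 : v k = f z k := by simpa using h
        exact h2.symm
    · rintro ⟨u, rfl⟩ k
      by_cases hk : k ∈ Set.range s
      · left; exact if_pos hk
      · right
        simp only [if_neg hk, toFace]
        rw [hoff _ _ hk]
end

section
/- Let d ≥ 2 and let M be a subcomplex of I^n of dimension d whose geometric realization |M| is a connected compact topological d-manifold without boundary (in particular a ℤ/2-homology d-manifold, the paper's hypothesis). If S ⊆ M is a subcomplex whose geometric realization |S| is homeomorphic to the unit sphere in ℝ^{d+1}, then S = M. -/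
open CategoryTheory in
/-- The `j`-th singular homology of a topological space with coefficients in `R`. -/
noncomputable def sHomology (R : Type) [CommRing R] (X : Type) [TopologicalSpace X]
    (j : ℕ) : ModuleCat R :=
  ((AlgebraicTopology.alternatingFaceMapComplex (ModuleCat R)).obj
    (((SimplicialObject.whiskering _ _).obj (ModuleCat.free R)).obj
      (TopCat.toSSet.obj (TopCat.of X)))).homology j

/-- `X` is a compact topological `d`-manifold without boundary. -/
def IsCompactManifold (X : Type) [TopologicalSpace X] (d : ℕ) : Prop :=
  CompactSpace X ∧ Nonempty (ChartedSpace (EuclideanSpace ℝ (Fin d)) X)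

section
open Set Filter Topology MeasureTheory Metric
open scoped NNReal

theorem poly_det {d : ℕ} (A : EuclideanSpace ℝ (Fin d) → EuclideanSpace ℝ (Fin d) →L[ℝ] EuclideanSpace ℝ (Fin d))
    (hA : Continuous A) :
    ∃ p : Polynomial C(EuclideanSpace ℝ (Fin d), ℝ), ∀ (t : ℝ) x,
      (ContinuousLinearMap.id ℝ _ + t • A x).det = (p.eval (ContinuousMap.const _ t)) x := by
  let b := (EuclideanSpace.basisFun (Fin d) ℝ).toBasis
  have hc : ∀ i j, Continuous fun x => LinearMap.toMatrix b b (A x : _ →ₗ[ℝ] _) i j := by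
    intro i j
    simp only [LinearMap.toMatrix_apply]
    have : Continuous fun x => (A x) (b j) := by fun_prop
    simp only [b, OrthonormalBasis.coe_toBasis_repr_apply, EuclideanSpace.basisFun_repr]
    simp only [ContinuousLinearMap.coe_coe]
    exact (EuclideanSpace.proj (𝕜 := ℝ) i).continuous.comp this
  let P : Matrix (Fin d) (Fin d) (Polynomial C(EuclideanSpace ℝ (Fin d), ℝ)) := fun i j =>
    (if i = j then 1 else 0) + Polynomial.X * Polynomial.C ⟨_, hc i j⟩
  refine ⟨P.det, fun t x => ?_⟩
  rw [ContinuousLinearMap.det, ← LinearMap.det_toMatrix b]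
  let φ : Polynomial C(EuclideanSpace ℝ (Fin d), ℝ) →+* ℝ :=
    (ContinuousMap.evalAlgHom ℝ ℝ x : _ →+* ℝ).comp (Polynomial.evalRingHom (ContinuousMap.const _ t))
  have h : (P.det.eval (ContinuousMap.const _ t)) x = φ P.det := rfl
  rw [h, RingHom.map_det]
  congr 1
  refine Matrix.ext fun i j => ?_
  have hP : P i j = (if i = j then 1 else 0) + Polynomial.X * Polynomial.C ⟨_, hc i j⟩ := rfl
  have h1 : φ Polynomial.X = t := by simp [φ]
  have h2 : φ (Polynomial.C ⟨_, hc i j⟩) = LinearMap.toMatrix b b (A x : _ →ₗ[ℝ] _) i j := by simp [φ]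
  rw [RingHom.mapMatrix_apply, Matrix.map_apply, hP, map_add, map_mul, h1, h2]
  simp only [ContinuousLinearMap.toLinearMap_add, ContinuousLinearMap.toLinearMap_smul, map_add, map_smul,
    ContinuousLinearMap.coe_id, LinearMap.toMatrix_id, Matrix.add_apply, Matrix.smul_apply, smul_eq_mul]
  congr 1
  by_cases hij : i = j
  · subst hij
    rw [if_pos rfl, map_one]
    exact Matrix.one_apply_eq i
  · rw [if_neg hij, map_zero]
    exact Matrix.one_apply_ne hij

theorem poly_base {d : ℕ} (u : EuclideanSpace ℝ (Fin d) → EuclideanSpace ℝ (Fin d))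
    (hu : Continuous u) (K : ℝ) (k : ℕ) :
    ∃ p : Polynomial C(EuclideanSpace ℝ (Fin d), ℝ), ∀ (t : ℝ) x,
      (1 - ‖x + t • u x‖ ^ 2 / K ^ 2) ^ k = (p.eval (ContinuousMap.const _ t)) x := by
  let a : C(EuclideanSpace ℝ (Fin d), ℝ) := ⟨fun x => 1 - ‖x‖ ^ 2 / K ^ 2, by fun_prop⟩
  let b : C(EuclideanSpace ℝ (Fin d), ℝ) := ⟨fun x => - (2 * inner ℝ x (u x)) / K ^ 2, by fun_prop⟩
  let c : C(EuclideanSpace ℝ (Fin d), ℝ) := ⟨fun x => - ‖u x‖ ^ 2 / K ^ 2, by fun_prop⟩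
  refine ⟨(Polynomial.C a + Polynomial.X * Polynomial.C b + Polynomial.X ^ 2 * Polynomial.C c) ^ k,
    fun t x => ?_⟩
  simp only [Polynomial.eval_pow, Polynomial.eval_add, Polynomial.eval_mul, Polynomial.eval_C,
    Polynomial.eval_X, ContinuousMap.pow_apply, ContinuousMap.add_apply, ContinuousMap.mul_apply,
    ContinuousMap.const_apply, a, b, c, ContinuousMap.coe_mk]
  congr 1
  rw [norm_add_sq_real, inner_smul_right, norm_smul, mul_pow, Real.norm_eq_abs, sq_abs]
  ring

theorem poly_integral {d : ℕ} (p : Polynomial C(EuclideanSpace ℝ (Fin d), ℝ)) (R : ℝ) :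
    ∃ q : Polynomial ℝ, ∀ t : ℝ,
      ∫ x in closedBall (0 : EuclideanSpace ℝ (Fin d)) R, (p.eval (ContinuousMap.const _ t)) x
        = q.eval t := by
  refine ⟨∑ i ∈ Finset.range (p.natDegree + 1), Polynomial.monomial i
    (∫ x in closedBall (0 : EuclideanSpace ℝ (Fin d)) R, (p.coeff i) x), fun t => ?_⟩
  rw [Polynomial.eval_finsetSum]
  simp only [Polynomial.eval_monomial]
  simp only [Polynomial.eval_eq_sum_range, ContinuousMap.coe_sum, Finset.sum_apply,
    ContinuousMap.mul_apply, ContinuousMap.pow_apply, ContinuousMap.const_apply]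
  rw [integral_finsetSum]
  · refine Finset.sum_congr rfl fun i _ => ?_
    rw [integral_mul_const]
  · intro i _
    have : Continuous fun x => (p.coeff i) x * t ^ i := by fun_prop
    exact this.continuousOn.integrableOn_compact (isCompact_closedBall _ _)

theorem small_t {d : ℕ} (u : EuclideanSpace ℝ (Fin d) → EuclideanSpace ℝ (Fin d))
    (hu : ContDiff ℝ 1 u) (R : ℝ) (hR : ∀ x, R ≤ ‖x‖ → u x = 0) :
    ∃ ε > 0, ∀ t : ℝ, 0 ≤ t → t < ε → ∀ g : EuclideanSpace ℝ (Fin d) → ℝ,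
      ∫ x in closedBall (0 : EuclideanSpace ℝ (Fin d)) R,
        g (x + t • u x) * (ContinuousLinearMap.id ℝ _ + t • fderiv ℝ u x).det
      = ∫ x in closedBall (0 : EuclideanSpace ℝ (Fin d)) R, g x := by
  have hcs : HasCompactSupport u := by
    refine HasCompactSupport.intro (isCompact_closedBall 0 R) fun x hx => hR x ?_
    rw [mem_closedBall_zero_iff, not_le] at hx
    exact hx.le
  obtain ⟨L, hL⟩ := hu.lipschitzWith_of_hasCompactSupport hcs (by simp)
  have hdetc : Continuous fun A : EuclideanSpace ℝ (Fin d) →L[ℝ] EuclideanSpace ℝ (Fin d) =>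
      (ContinuousLinearMap.id ℝ _ + A).det :=
    ContinuousLinearMap.continuous_det.comp (by fun_prop)
  have h0 : (0 : ℝ) < (ContinuousLinearMap.id ℝ (EuclideanSpace ℝ (Fin d)) + 0).det := by
    simp [ContinuousLinearMap.det]
  obtain ⟨η, hη, hηp⟩ := Metric.eventually_nhds_iff.1 (hdetc.continuousAt.eventually_const_lt h0)
  refine ⟨min 1 η / (L + 1), by positivity, fun t ht0 ht g => ?_⟩
  rw [lt_div_iff₀ (by positivity)] at ht
  have htL1 : t * L < 1 := by nlinarith [min_le_left 1 η]
  have htLη : t * L < η := by nlinarith [min_le_right 1 η]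
  have hdet : ∀ x, 0 < (ContinuousLinearMap.id ℝ _ + t • fderiv ℝ u x).det := by
    intro x
    apply hηp
    rw [dist_zero_right, norm_smul, Real.norm_eq_abs, abs_of_nonneg ht0]
    have := norm_fderiv_le_of_lipschitz ℝ hL (x₀ := x)
    nlinarith
  have hder : ∀ x, HasFDerivAt (fun x => x + t • u x) (ContinuousLinearMap.id ℝ _ + t • fderiv ℝ u x) x := by
    intro x
    exact (hasFDerivAt_id x).add (((hu.differentiable (by simp)) x).hasFDerivAt.const_smul t)
  have hinj : Function.Injective fun x => x + t • u x := by
    intro x y hxy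
    by_contra hne
    have h1 : x - y = t • (u y - u x) := by
      rw [smul_sub]
      have : x + t • u x = y + t • u y := hxy
      rw [sub_eq_sub_iff_add_eq_add, this, add_comm]
    have h2 : ‖x - y‖ = t * ‖u x - u y‖ := by
      rw [h1, norm_smul, Real.norm_eq_abs, abs_of_nonneg ht0, norm_sub_rev]
    have h3 := hL.norm_sub_le x y
    have h4 : 0 < ‖x - y‖ := norm_pos_iff.2 (sub_ne_zero.2 hne)
    nlinarith
  have hsurj : Function.Surjective fun x => x + t • u x := by
    intro y
    have hct : ContractingWith (Real.toNNReal (t * L)) fun x => y - t • u x := by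
      refine ⟨by simpa using htL1, LipschitzWith.of_dist_le_mul fun a b => ?_⟩
      rw [Real.coe_toNNReal _ (by positivity), dist_sub_left, dist_smul₀, Real.norm_eq_abs, abs_of_nonneg ht0, mul_assoc]
      exact mul_le_mul_of_nonneg_left (hL.dist_le_mul a b) ht0
    refine ⟨hct.fixedPoint, ?_⟩
    have := hct.fixedPoint_isFixedPt
    unfold Function.IsFixedPt at this
    simp only at this ⊢
    nth_rw 1 [← this]
    simp
  have himg : (fun x => x + t • u x) '' closedBall 0 R = closedBall 0 R := by
    have hfix : ∀ x, x ∉ closedBall (0 : EuclideanSpace ℝ (Fin d)) R → x + t • u x = x := by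
      intro x hx
      rw [mem_closedBall_zero_iff, not_le] at hx
      simp [hR x hx.le]
    ext y
    constructor
    · rintro ⟨x, hx, rfl⟩
      by_contra hy
      have := hinj (hfix _ hy)
      simp only at this hy
      rw [this] at hy
      exact hy hx
    · intro hy
      obtain ⟨x, rfl⟩ := hsurj y
      refine ⟨x, ?_, rfl⟩
      by_contra hx
      simp only [hfix x hx] at hy
      exact hx hy
  have key := integral_image_eq_integral_abs_det_fderiv_smul volume
    (isClosed_closedBall (x := (0 : EuclideanSpace ℝ (Fin d))) (ε := R)).measurableSet
    (fun x _ => (hder x).hasFDerivWithinAt) hinj.injOn g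
  rw [himg] at key
  rw [key]
  congr 1
  ext x
  rw [abs_of_pos (hdet x), smul_eq_mul, mul_comm]

theorem const_integral {d : ℕ} (u : EuclideanSpace ℝ (Fin d) → EuclideanSpace ℝ (Fin d))
    (hu : ContDiff ℝ 1 u) (R : ℝ) (hR : ∀ x, R ≤ ‖x‖ → u x = 0) (K : ℝ) (k : ℕ) :
    ∫ x in closedBall (0 : EuclideanSpace ℝ (Fin d)) R,
      (1 - ‖x + u x‖ ^ 2 / K ^ 2) ^ k * (ContinuousLinearMap.id ℝ _ + fderiv ℝ u x).det
    = ∫ x in closedBall (0 : EuclideanSpace ℝ (Fin d)) R, (1 - ‖x‖ ^ 2 / K ^ 2) ^ k := by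
  obtain ⟨p, hp⟩ := poly_det (fderiv ℝ u) (hu.continuous_fderiv (by simp))
  obtain ⟨p', hp'⟩ := poly_base u hu.continuous K k
  obtain ⟨q, hq⟩ := poly_integral (p' * p) R
  obtain ⟨ε, hε, h⟩ := small_t u hu R hR
  set c := ∫ x in closedBall (0 : EuclideanSpace ℝ (Fin d)) R, (1 - ‖x‖ ^ 2 / K ^ 2) ^ k
  have h1 : ∀ t, q.eval t = ∫ x in closedBall (0 : EuclideanSpace ℝ (Fin d)) R,
      (1 - ‖x + t • u x‖ ^ 2 / K ^ 2) ^ k * (ContinuousLinearMap.id ℝ _ + t • fderiv ℝ u x).det := by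
    intro t
    rw [← hq]
    simp only [hp, hp', Polynomial.eval_mul, ContinuousMap.mul_apply]
  have h2 : q = Polynomial.C c := by
    apply Polynomial.eq_of_infinite_eval_eq
    refine (Ioo_infinite hε).mono fun t ht => ?_
    simp only [mem_ofPred_eq, Polynomial.eval_C]
    rw [h1]
    exact h t ht.1.le ht.2 (fun x => (1 - ‖x‖ ^ 2 / K ^ 2) ^ k)
  have h3 := h1 1
  rw [h2] at h3
  simp only [Polynomial.eval_C, one_smul] at h3
  exact h3.symm

theorem near_zero {d : ℕ} (u : EuclideanSpace ℝ (Fin d) → EuclideanSpace ℝ (Fin d))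
    (hu : ContDiff ℝ 1 u) (R : ℝ) (hR0 : 0 < R) (hR : ∀ x, R ≤ ‖x‖ → u x = 0) (δ : ℝ) (hδ : 0 < δ) :
    ∃ x, ‖x + u x‖ < δ := by
  by_contra! hcon
  wlog hδR : δ ≤ R generalizing δ
  · exact this R hR0 (fun x => (not_le.1 hδR).le.trans (hcon x)) le_rfl
  obtain ⟨U, hU⟩ := (isCompact_closedBall (0 : EuclideanSpace ℝ (Fin d)) R).exists_bound_of_continuousOn
    hu.continuous.continuousOn
  have hdc : Continuous fun x => (ContinuousLinearMap.id ℝ (EuclideanSpace ℝ (Fin d)) + fderiv ℝ u x).det :=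
    ContinuousLinearMap.continuous_det.comp
      (continuous_const.add (hu.continuous_fderiv (by simp)))
  obtain ⟨D, hD⟩ := (isCompact_closedBall (0 : EuclideanSpace ℝ (Fin d)) R).exists_bound_of_continuousOn
    hdc.continuousOn
  set B := closedBall (0 : EuclideanSpace ℝ (Fin d)) R with hB
  have hU0 : 0 ≤ U := (norm_nonneg _).trans (hU 0 (by simp [hB, hR0.le]))
  have hD0 : 0 ≤ D := (norm_nonneg _).trans (hD 0 (by simp [hB, hR0.le]))
  set K := R + U with hK
  have hKpos : 0 < K := by positivity
  set a := 1 - δ ^ 2 / K ^ 2 with ha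
  set b := 1 - (δ / 2) ^ 2 / K ^ 2 with hb
  have ha0 : 0 ≤ a := by
    rw [ha, sub_nonneg, div_le_one (by positivity)]
    gcongr
    linarith
  have hab : a < b := by
    rw [ha, hb]
    gcongr
    linarith
  have hb0 : 0 < b := ha0.trans_lt hab
  set V := (volume B).toReal
  set W := (volume (closedBall (0 : EuclideanSpace ℝ (Fin d)) (δ / 2))).toReal with hW
  have hWpos : 0 < W := by
    refine ENNReal.toReal_pos (measure_closedBall_pos _ _ (by positivity)).ne' ?_
    exact measure_closedBall_lt_top.ne
  have hmain : ∀ k : ℕ, W * b ^ k ≤ (D * V) * a ^ k := by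
    intro k
    have hcont : Continuous fun x : EuclideanSpace ℝ (Fin d) => (1 - ‖x‖ ^ 2 / K ^ 2) ^ k := by fun_prop
    have e := const_integral u hu R hR K k
    have up : ‖∫ x in B, (1 - ‖x + u x‖ ^ 2 / K ^ 2) ^ k *
        (ContinuousLinearMap.id ℝ _ + fderiv ℝ u x).det‖ ≤ (a ^ k * D) * V := by
      apply norm_setIntegral_le_of_norm_le_const measure_closedBall_lt_top
      intro x hx
      have hx' : ‖x‖ ≤ R := by simpa [hB] using hx
      have h1 : ‖x + u x‖ ≤ K := (norm_add_le _ _).trans (add_le_add hx' (hU x hx))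
      rw [norm_mul, norm_pow]
      have h2 : 0 ≤ 1 - ‖x + u x‖ ^ 2 / K ^ 2 := by
        rw [sub_nonneg, div_le_one (by positivity)]
        gcongr
      have h3 : 1 - ‖x + u x‖ ^ 2 / K ^ 2 ≤ a := by
        rw [ha]
        gcongr
        exact hcon x
      rw [Real.norm_of_nonneg h2]
      exact mul_le_mul (pow_le_pow_left₀ h2 h3 k) (hD x hx) (norm_nonneg _) (by positivity)
    have lo : b ^ k * W ≤ ∫ x in B, (1 - ‖x‖ ^ 2 / K ^ 2) ^ k := by
      calc b ^ k * W = ∫ x in closedBall (0 : EuclideanSpace ℝ (Fin d)) (δ / 2), b ^ k := by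
            rw [setIntegral_const, smul_eq_mul, mul_comm]; rfl
        _ ≤ ∫ x in closedBall (0 : EuclideanSpace ℝ (Fin d)) (δ / 2), (1 - ‖x‖ ^ 2 / K ^ 2) ^ k := by
            apply setIntegral_mono_on
            · exact continuous_const.continuousOn.integrableOn_compact (isCompact_closedBall _ _)
            · exact hcont.continuousOn.integrableOn_compact (isCompact_closedBall _ _)
            · exact isClosed_closedBall.measurableSet
            · intro x hx
              have hx' : ‖x‖ ≤ δ / 2 := by simpa using hx
              apply pow_le_pow_left₀ hb0.le
              rw [hb]
              gcongr
        _ ≤ _ := by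
            apply setIntegral_mono_set
            · exact hcont.continuousOn.integrableOn_compact (isCompact_closedBall _ _)
            · refine (ae_restrict_iff' isClosed_closedBall.measurableSet).2 (ae_of_all _ fun x hx => ?_)
              have hx' : ‖x‖ ≤ R := by simpa using hx
              have : ‖x‖ ≤ K := by linarith
              apply pow_nonneg
              rw [sub_nonneg, div_le_one (by positivity)]
              gcongr
            · exact (closedBall_subset_closedBall (by linarith)).eventuallyLE
    rw [e] at up
    have := (le_abs_self _).trans up
    linarith
  have hlim : Tendsto (fun k : ℕ => (D * V) * (a / b) ^ k) atTop (𝓝 ((D * V) * 0)) :=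
    (tendsto_pow_atTop_nhds_zero_of_lt_one (by positivity) ((div_lt_one hb0).2 hab)).const_mul _
  rw [mul_zero] at hlim
  obtain ⟨k, hk⟩ := (hlim.eventually_lt_const hWpos).exists
  have h1 := hmain k
  rw [div_pow, mul_div_assoc', div_lt_iff₀ (by positivity)] at hk
  linarith

theorem zero_of_compact {d : ℕ} (u : EuclideanSpace ℝ (Fin d) → EuclideanSpace ℝ (Fin d))
    (hu : Continuous u) (R : ℝ) (hR0 : 0 < R) (hR : ∀ x, R ≤ ‖x‖ → u x = 0) :
    ∃ x, x + u x = 0 := by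
  by_contra! hcon
  obtain ⟨x0, hx0, hmin⟩ := (isCompact_closedBall (0 : EuclideanSpace ℝ (Fin d)) R).exists_isMinOn
    ⟨0, by simp [hR0.le]⟩ (f := fun x => ‖x + u x‖) (by fun_prop)
  have hpos : 0 < ‖x0 + u x0‖ := norm_pos_iff.2 (hcon x0)
  set δ := min ‖x0 + u x0‖ R with hδ
  have hδ0 : 0 < δ := lt_min hpos hR0
  have hlow : ∀ x, δ ≤ ‖x + u x‖ := by
    intro x
    rcases le_total R ‖x‖ with h | h
    · rw [hR x h, add_zero]
      exact (min_le_right _ _).trans h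
    · exact (min_le_left _ _).trans (hmin (by simpa using h))
  have hcs : HasCompactSupport u := by
    refine HasCompactSupport.intro (isCompact_closedBall 0 R) fun x hx => hR x ?_
    rw [mem_closedBall_zero_iff, not_le] at hx
    exact hx.le
  have huc : UniformContinuous u := hcs.uniformContinuous_of_continuous hu
  obtain ⟨η, hη, hηu⟩ := Metric.uniformContinuous_iff.1 huc (δ / 2) (half_pos hδ0)
  obtain ⟨g, hg, hgu⟩ := hu.exists_contDiff_dist_le_of_forall_mem_ball_dist_le hη
  have hclose : ∀ a, dist (g a) (u a) ≤ δ / 2 := fun a => hgu a _ fun x hx => (hηu hx).le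
  obtain ⟨x, hx⟩ := near_zero g (hg.of_le (by exact_mod_cast le_top)) (R + η) (by positivity)
    (by
      intro x hx
      have h1 : ∀ y ∈ ball x η, dist (u y) (u x) ≤ 0 := by
        intro y hy
        have h2 : u y = 0 := by
          apply hR
          have := norm_sub_norm_le x y
          rw [mem_ball, dist_comm, dist_eq_norm] at hy
          linarith
        rw [h2, hR x (by linarith)]
        simp
      have h3 := dist_le_zero.1 (hgu x 0 h1)
      rw [h3, hR x (by linarith)]) (δ / 2) (half_pos hδ0)
  have h1 := hlow x
  have h2 := hclose x
  have h3 : ‖x + u x‖ ≤ ‖x + g x‖ + ‖u x - g x‖ := by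
    have : x + u x = (x + g x) + (u x - g x) := by abel
    rw [this]
    exact norm_add_le _ _
  rw [dist_comm, dist_eq_norm] at h2
  linarith

theorem zero_on_ball {d : ℕ} (h : EuclideanSpace ℝ (Fin d) → EuclideanSpace ℝ (Fin d))
    (hc : ContinuousOn h (closedBall 0 1)) (hb : ∀ x ∈ closedBall 0 1, ‖h x - x‖ ≤ 1 / 2) :
    ∃ x ∈ closedBall 0 1, h x = 0 := by
  let ρ : EuclideanSpace ℝ (Fin d) → EuclideanSpace ℝ (Fin d) := fun x => (max 1 ‖x‖)⁻¹ • x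
  have hmax : ∀ x : EuclideanSpace ℝ (Fin d), 0 < max 1 ‖x‖ := fun x => lt_max_of_lt_left one_pos
  have hρc : Continuous ρ := by
    refine Continuous.smul (Continuous.inv₀ (by fun_prop) fun x => (hmax x).ne') continuous_id
  have hρm : ∀ x, ρ x ∈ closedBall (0 : EuclideanSpace ℝ (Fin d)) 1 := by
    intro x
    rw [mem_closedBall_zero_iff, norm_smul, norm_inv, Real.norm_of_nonneg (hmax x).le,
      inv_mul_le_iff₀ (hmax x), mul_one]
    exact le_max_right _ _
  have hρid : ∀ x, ‖x‖ ≤ 1 → ρ x = x := by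
    intro x hx
    simp [ρ, max_eq_left hx]
  let u : EuclideanSpace ℝ (Fin d) → EuclideanSpace ℝ (Fin d) :=
    fun x => (max 0 (min 1 (2 - ‖x‖))) • (h (ρ x) - ρ x)
  have huc : Continuous u := by
    have hm : Continuous fun x : EuclideanSpace ℝ (Fin d) => max 0 (min 1 (2 - ‖x‖)) := by fun_prop
    refine hm.smul (Continuous.sub ?_ hρc)
    exact hc.comp_continuous hρc hρm
  obtain ⟨x, hx⟩ := zero_of_compact u huc 2 two_pos (by
    intro x hx
    have : max 0 (min 1 (2 - ‖x‖)) = 0 := max_eq_left ((min_le_right _ _).trans (by linarith))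
    simp [u, this])
  have hux : ‖u x‖ ≤ 1 / 2 := by
    have h1 : max 0 (min 1 (2 - ‖x‖)) ≤ 1 := max_le zero_le_one (min_le_left _ _)
    have h0 : 0 ≤ max 0 (min 1 (2 - ‖x‖)) := le_max_left _ _
    rw [norm_smul, Real.norm_of_nonneg h0]
    have := hb (ρ x) (hρm x)
    nlinarith [norm_nonneg (h (ρ x) - ρ x)]
  have hxn : ‖x‖ ≤ 1 / 2 := by
    rw [eq_neg_of_add_eq_zero_left hx, norm_neg]
    exact hux
  have h1 : max 0 (min 1 (2 - ‖x‖)) = 1 := by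
    rw [min_eq_left (by linarith)]
    simp
  refine ⟨x, by simpa using hxn.trans (by norm_num), ?_⟩
  simp only [u, h1, hρid x (by linarith), one_smul] at hx
  simpa using hx

theorem smooth_approx {d : ℕ} (G : C(EuclideanSpace ℝ (Fin d), EuclideanSpace ℝ (Fin d)))
    (C : Set (EuclideanSpace ℝ (Fin d))) (hC : IsCompact C) (ε : ℝ) (hε : 0 < ε) :
    ∃ g : EuclideanSpace ℝ (Fin d) → EuclideanSpace ℝ (Fin d),
      Differentiable ℝ g ∧ ∀ x ∈ C, ‖g x - G x‖ ≤ ε := by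
  have : UniformContinuousOn G (cthickening 1 C) :=
    hC.cthickening.uniformContinuousOn_of_continuous <| by fun_prop
  rcases Metric.uniformContinuousOn_iff.mp this ε hε with ⟨δ, hδ, hfδ⟩
  rcases (map_continuous G).exists_contDiff_dist_le_of_forall_mem_ball_dist_le
    (lt_min one_pos hδ) with ⟨g, hgc, hg⟩
  refine ⟨g, hgc.differentiable (by simp), fun x hx ↦ ?_⟩
  rw [← dist_eq_norm]
  refine hg _ _ fun y hy ↦ ?_
  rw [mem_ball, lt_min_iff] at hy
  exact hfδ _ (mem_cthickening_of_dist_le _ x _ _ hx hy.1.le) _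
    (self_subset_cthickening _ hx) hy.2 |>.le

theorem domain_ball {d : ℕ} (f : EuclideanSpace ℝ (Fin d) → EuclideanSpace ℝ (Fin d))
    (hc : ContinuousOn f (closedBall 0 1)) (hi : InjOn f (closedBall 0 1)) :
    f '' closedBall 0 1 ∈ 𝓝 (f 0) := by
  by_contra hn
  set B := closedBall (0 : EuclideanSpace ℝ (Fin d)) 1 with hB
  have hBc : IsCompact B := isCompact_closedBall _ _
  have h0B : (0 : EuclideanSpace ℝ (Fin d)) ∈ B := by simp [hB]
  have hKc : IsCompact (f '' B) := hBc.image_of_continuousOn hc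
  have : CompactSpace B := isCompact_iff_compactSpace.1 hBc
  have hemb : IsClosedEmbedding (fun x : B => f x) :=
    Continuous.isClosedEmbedding (continuousOn_iff_continuous_domRestrict.1 hc)
      (fun x y hxy => Subtype.ext (hi x.2 y.2 hxy))
  obtain ⟨G, hG⟩ := ContinuousMap.exists_extension' hemb
    (⟨Subtype.val, continuous_subtype_val⟩ : C(B, EuclideanSpace ℝ (Fin d)))
  have hGf : ∀ x ∈ B, G (f x) = x := fun x hx => congrFun hG ⟨x, hx⟩
  have hG0 : G (f 0) = 0 := hGf 0 h0B
  obtain ⟨ε', hε', hGε⟩ := Metric.continuousAt_iff.1 ((map_continuous G).continuousAt (x := f 0)) (1 / 10) (by norm_num)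
  rw [hG0] at hGε
  set ε := ε' / 3 with hε
  have hε0 : 0 < ε := by positivity
  obtain ⟨c, hcb, hcK⟩ : ∃ c ∈ ball (f 0) ε, c ∉ f '' B := by
    by_contra! hall
    exact hn (mem_of_superset (ball_mem_nhds _ hε0) hall)
  rw [mem_ball] at hcb
  have hS1c : IsCompact (f '' B \ ball c ε) := hKc.diff isOpen_ball
  have hGne : ∀ y ∈ f '' B \ ball c ε, G y ≠ 0 := by
    rintro y ⟨⟨x, hx, rfl⟩, hy⟩ h
    rw [hGf x hx] at h
    subst h
    exact hy (by rw [mem_ball, dist_comm]; exact hcb)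
  obtain ⟨δ, hδ0, hδ⟩ : ∃ δ > 0, ∀ y ∈ f '' B \ ball c ε, δ ≤ ‖G y‖ := by
    rcases (f '' B \ ball c ε).eq_empty_or_nonempty with h | h
    · exact ⟨1, one_pos, by simp [h]⟩
    · obtain ⟨y0, hy0, hmin⟩ := hS1c.exists_isMinOn h (f := fun y => ‖G y‖) (by fun_prop)
      exact ⟨‖G y0‖, norm_pos_iff.2 (hGne y0 hy0), fun y hy => hmin hy⟩
  set η := min (δ / 3) (1 / 10) with hη
  have hη0 : 0 < η := by positivity
  have hη1 : η ≤ δ / 3 := min_le_left _ _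
  have hη2 : η ≤ 1 / 10 := min_le_right _ _
  obtain ⟨P, hPd, hP⟩ := smooth_approx G ((f '' B \ ball c ε) ∪ sphere c ε)
    (hS1c.union (isCompact_sphere _ _)) η hη0
  have hnull : volume (P '' sphere c ε) = 0 :=
    addHaar_image_eq_zero_of_differentiableOn_of_addHaar_eq_zero volume hPd.differentiableOn
      (Measure.addHaar_sphere_of_ne_zero volume c hε0.ne')
  obtain ⟨v, hv, hvP⟩ : ∃ v ∈ ball (0 : EuclideanSpace ℝ (Fin d)) η, v ∉ P '' sphere c ε := by
    by_contra! hall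
    exact (measure_ball_pos volume (0 : EuclideanSpace ℝ (Fin d)) hη0).ne' (measure_mono_null hall hnull)
  rw [mem_ball_zero_iff] at hv
  let Φ : EuclideanSpace ℝ (Fin d) → EuclideanSpace ℝ (Fin d) :=
    fun y => c + (max (ε / ‖y - c‖) 1) • (y - c)
  have hΦc : ContinuousOn Φ (f '' B) := by
    have hsub : ContinuousOn (fun y : EuclideanSpace ℝ (Fin d) => y - c) (f '' B) := by fun_prop
    suffices hm : ContinuousOn (fun y : EuclideanSpace ℝ (Fin d) => max (ε / ‖y - c‖) 1) (f '' B) from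
      continuousOn_const.add (hm.smul hsub)
    refine ContinuousOn.sup (ContinuousOn.div continuousOn_const hsub.norm ?_) continuousOn_const
    intro y hy
    rw [norm_ne_zero_iff, sub_ne_zero]
    rintro rfl
    exact hcK hy
  have hΦ1 : ∀ y, ε ≤ ‖y - c‖ → Φ y = y := by
    intro y hy
    have : ε / ‖y - c‖ ≤ 1 := (div_le_one (hε0.trans_le hy)).2 hy
    simp [Φ, max_eq_right this]
  have hΦ2 : ∀ y, y ≠ c → ‖y - c‖ ≤ ε → ‖Φ y - c‖ = ε := by
    intro y hyc hy
    have hp : 0 < ‖y - c‖ := norm_pos_iff.2 (sub_ne_zero.2 hyc)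
    have : 1 ≤ ε / ‖y - c‖ := (one_le_div hp).2 hy
    simp only [Φ, max_eq_left this, add_sub_cancel_left]
    rw [norm_smul, Real.norm_of_nonneg (by positivity)]
    field_simp
  have hS2 : ∀ y, ‖y - c‖ = ε → P y - v ≠ 0 := by
    intro y hy h
    exact hvP ⟨y, by rw [mem_sphere, dist_eq_norm]; exact hy, sub_eq_zero.1 h⟩
  have hPv : ∀ y ∈ (f '' B \ ball c ε) ∪ sphere c ε, ‖(P y - v) - G y‖ ≤ 2 * η := by
    intro y hy
    have : (P y - v) - G y = (P y - G y) - v := by abel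
    rw [this]
    have := norm_sub_le (P y - G y) v
    have := hP y hy
    linarith
  have hS1 : ∀ y ∈ f '' B \ ball c ε, P y - v ≠ 0 := by
    intro y hy h
    have h1 := hPv y (Or.inl hy)
    rw [h, zero_sub, norm_neg] at h1
    have := hδ y hy
    linarith
  obtain ⟨x, hx, hx0⟩ := zero_on_ball (fun x => P (Φ (f x)) - v)
    ((hPd.continuous.comp_continuousOn (hΦc.comp hc (mapsTo_image f B))).sub continuousOn_const)
    (by
      intro x hx
      have hfx : f x ∈ f '' B := ⟨x, hx, rfl⟩
      rcases le_total ε ‖f x - c‖ with h | h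
      · simp only [hΦ1 _ h]
        have h1 := hPv (f x) (Or.inl ⟨hfx, by rw [mem_ball, dist_eq_norm, not_lt]; exact h⟩)
        rw [hGf x hx] at h1
        linarith
      · have hne : f x ≠ c := by
          intro h'
          exact hcK (h' ▸ hfx)
        have h2 := hΦ2 _ hne h
        have h1 := hPv (Φ (f x)) (Or.inr (by rw [mem_sphere, dist_eq_norm]; exact h2))
        have h3 : ‖G (Φ (f x))‖ < 1 / 10 := by
          rw [← dist_zero_right]
          apply hGε
          have := dist_triangle (Φ (f x)) c (f 0)
          rw [dist_eq_norm (Φ (f x)) c] at this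
          linarith
        have h4 : ‖x‖ < 1 / 10 := by
          have h5 : dist (f x) (f 0) < ε' := by
            have := dist_triangle (f x) c (f 0)
            rw [dist_eq_norm (f x) c] at this
            linarith
          have := hGε h5
          rwa [hGf x hx, dist_zero_right] at this
        have h6 : (P (Φ (f x)) - v) - x = ((P (Φ (f x)) - v) - G (Φ (f x))) + G (Φ (f x)) - x := by abel
        rw [h6]
        have h7 := norm_sub_le (((P (Φ (f x)) - v) - G (Φ (f x))) + G (Φ (f x))) x
        have h8 := norm_add_le ((P (Φ (f x)) - v) - G (Φ (f x))) (G (Φ (f x)))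
        linarith)
  have hfx : f x ∈ f '' B := ⟨x, hx, rfl⟩
  rcases le_total ε ‖f x - c‖ with h | h
  · rw [hΦ1 _ h] at hx0
    exact hS1 (f x) ⟨hfx, by rw [mem_ball, dist_eq_norm, not_lt]; exact h⟩ hx0
  · have hne : f x ≠ c := by
      intro h'
      exact hcK (h' ▸ hfx)
    exact hS2 _ (hΦ2 _ hne h) hx0

/-- Invariance of domain. -/
theorem invariance_of_domain {d : ℕ} (f : EuclideanSpace ℝ (Fin d) → EuclideanSpace ℝ (Fin d))
    (U : Set (EuclideanSpace ℝ (Fin d))) (hU : IsOpen U)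
    (hc : ContinuousOn f U) (hi : InjOn f U) (x : EuclideanSpace ℝ (Fin d)) (hx : x ∈ U) :
    f '' U ∈ 𝓝 (f x) := by
  obtain ⟨r, hr, hrU⟩ := Metric.nhds_basis_closedBall.mem_iff.1 (hU.mem_nhds hx)
  have hm : MapsTo (fun y => x + r • y) (closedBall 0 1) U := by
    intro y hy
    apply hrU
    rw [mem_closedBall_zero_iff] at hy
    rw [mem_closedBall, dist_eq_norm, add_sub_cancel_left, norm_smul, Real.norm_of_nonneg hr.le]
    nlinarith
  have h := domain_ball (fun y => f (x + r • y)) (hc.comp (by fun_prop) hm) (by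
    intro y hy z hz hyz
    have := hi (hm hy) (hm hz) hyz
    simpa [hr.ne'] using this)
  simp only [smul_zero, add_zero] at h
  refine mem_of_superset h ?_
  rintro _ ⟨y, hy, rfl⟩
  exact ⟨_, hm hy, rfl⟩

theorem isOpen_range_charted {d : ℕ} {X Y : Type} [TopologicalSpace X] [TopologicalSpace Y]
    [ChartedSpace (EuclideanSpace ℝ (Fin d)) X] [ChartedSpace (EuclideanSpace ℝ (Fin d)) Y]
    (j : X → Y) (hj : Continuous j) (hi : Function.Injective j) : IsOpen (range j) := by
  rw [isOpen_iff_mem_nhds]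
  rintro _ ⟨p, rfl⟩
  let a := chartAt (EuclideanSpace ℝ (Fin d)) p
  let c := chartAt (EuclideanSpace ℝ (Fin d)) (j p)
  have hpa : p ∈ a.source := mem_chart_source _ p
  have hpc : j p ∈ c.source := mem_chart_source _ (j p)
  have hcj : ContinuousOn (fun y => j (a.symm y)) a.target := hj.comp_continuousOn a.continuousOn_symm
  let V := a.target ∩ (fun y => j (a.symm y)) ⁻¹' c.source
  have hV : IsOpen V := hcj.isOpen_inter_preimage a.open_target c.open_source
  have key := invariance_of_domain (fun y => c (j (a.symm y))) V hV
    (c.continuousOn.comp (hcj.mono inter_subset_left) fun y hy => hy.2)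
    (by
      intro y hy z hz hyz
      exact a.symm.injOn hy.1 hz.1 (hi (c.injOn hy.2 hz.2 hyz)))
    (a p) ⟨a.map_source hpa, by simp [a.left_inv hpa, hpc]⟩
  simp only [a.left_inv hpa] at key
  have h1 := c.continuousAt hpc key
  rw [mem_map] at h1
  filter_upwards [h1, c.open_source.mem_nhds hpc] with q hq hqs
  obtain ⟨y, hy, hyq⟩ := hq
  exact ⟨a.symm y, c.injOn hy.2 hqs hyq⟩

theorem subcomplex_eq_of_real_subset {n : ℕ} (M S : Set (CubeFace n)) (hS : CubeFace.IsSubcomplex S)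
    (h : CubeFace.real M ⊆ CubeFace.real S) : M ⊆ S := by
  intro F hF
  let x : Fin n → ℝ := fun i => match F i with
    | none => 1 / 2
    | some false => 0
    | some true => 1
  have hx : x ∈ CubeFace.real M := by
    refine mem_iUnion₂.2 ⟨F, hF, fun i => ?_, fun i => ?_⟩
    · simp only [x]
      rcases F i with _ | _ | _ <;> norm_num
    · simp only [x]
      rcases F i with _ | _ | _
      · exact ⟨fun h => (Option.some_ne_none _ h.symm).elim, fun h => (Option.some_ne_none _ h.symm).elim⟩
      · norm_num
      · norm_num
  obtain ⟨G, hG, -, hGx⟩ := mem_iUnion₂.1 (h hx)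
  refine hS.2 G hG F fun i => ?_
  have hi := hGx i
  simp only [x] at hi
  revert hi
  rcases F i with _ | _ | _ <;> rcases G i with _ | _ | _ <;> norm_num

end

open CubeFace in
/-- if `M ⊆ I^n` is a connected cubical manifold of dimension `d ≥ 2` and
`S ⊆ M` is a subcomplex whose realization is homeomorphic to a `d`-sphere, then
`S = M`. -/
theorem sphere_subcomplex_is_whole_manifold
    {n d : ℕ} (hd : 2 ≤ d)
    (M : Set (CubeFace n)) (hM : IsSubcomplex M) (hdim : HasDim M d)
    (hman : IsCompactManifold (↥(real M)) d) (hconn : ConnectedSpace (↥(real M)))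
    (S : Set (CubeFace n)) (hS : IsSubcomplex S) (hSM : S ⊆ M)
    (hsphere : Nonempty
      ((↥(real S)) ≃ₜ (Metric.sphere (0 : EuclideanSpace ℝ (Fin (d + 1))) 1))) :
    S = M := by
  obtain ⟨-, ⟨hch⟩⟩ := hman
  obtain ⟨e⟩ := hsphere
  have hreal : real S ⊆ real M := Set.biUnion_subset_biUnion_left hSM
  let j : Metric.sphere (0 : EuclideanSpace ℝ (Fin (d + 1))) 1 → ↥(real M) :=
    fun q => Set.inclusion hreal (e.symm q)
  have hj : Continuous j := (continuous_inclusion hreal).comp e.symm.continuous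
  have hji : Function.Injective j := (Set.inclusion_injective hreal).comp e.symm.injective
  have hopen : IsOpen (Set.range j) := isOpen_range_charted (d := d) j hj hji
  have hclosed : IsClosed (Set.range j) := (isCompact_range hj).isClosed
  have hne : (Set.range j).Nonempty := by
    obtain ⟨F, hF⟩ := hS.1
    have hx : (fun i => if F i = some true then (1 : ℝ) else 0) ∈ real S := by
      refine Set.mem_iUnion₂.2 ⟨F, hF, fun i => ?_, fun i => ?_⟩
      · beta_reduce
        split_ifs <;> norm_num
      · beta_reduce
        exact ⟨fun h => by rw [h]; simp, fun h => if_pos h⟩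
    exact ⟨_, e ⟨_, hx⟩, rfl⟩
  have huniv : Set.range j = Set.univ := IsClopen.eq_univ ⟨hclosed, hopen⟩ hne
  refine Set.Subset.antisymm hSM (subcomplex_eq_of_real_subset M S hS ?_)
  intro x hx
  obtain ⟨q, hq⟩ : (⟨x, hx⟩ : ↥(real M)) ∈ Set.range j := huniv ▸ Set.mem_univ _
  have : x = (e.symm q : Fin n → ℝ) := (congrArg Subtype.val hq).symm
  rw [this]
  exact (e.symm q).2
end
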